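/- arXiv:2508.20855 — 2 statements merged into one kernel-verified Lean document; each statement's English description precedes it below -/
import Mathlib

section
/- Let T ≥ 2, let G_T = Δ_T(1,2,-1) and A_T = Δ_T(−(T−1)/2, −(T−2)/3, (T+1)/6). Then vec(A_T)′ (G_T⁻¹ ⊗ G_T⁻¹) vec(A_T) = (2T−1)(T+1)T(T−1)/36. -/
open Matrix
open scoped Matrix Kronecker

noncomputable section

/-- `tri n a b c` is the n×n tridiagonal matrix with (1,1) entry `a`, all other
diagonal entries `b`, all super- and sub-diagonal entries `c`, and zeros elsewhere. -/
def tri (n : ℕ) (a b c : ℝ) : Matrix (Fin n) (Fin n) ℝ :=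
  Matrix.of fun i j =>
    if (i : ℕ) = (j : ℕ) then (if (i : ℕ) = 0 then a else b)
    else if (i : ℕ) + 1 = (j : ℕ) ∨ (j : ℕ) + 1 = (i : ℕ) then c else 0

/-- Index set for `vech`: pairs (column j, row i) with j ≤ i, i.e. on-and-below-diagonal
positions, the order of the stacking being column-major. -/
abbrev VechIdx (T : ℕ) : Type := {p : Fin T × Fin T // (p.1 : ℕ) ≤ (p.2 : ℕ)}

/-- column-major vec: `vecM A (j, i) = A i j`. -/
def vecM {T : ℕ} (A : Matrix (Fin T) (Fin T) ℝ) : Fin T × Fin T → ℝ :=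
  fun p => A p.2 p.1

/-- half-vectorization: entries on and below the diagonal, column by column. -/
def vechM {T : ℕ} (A : Matrix (Fin T) (Fin T) ℝ) : VechIdx T → ℝ :=
  fun q => A q.val.2 q.val.1

/-- the duplication matrix: the unique matrix with `vecM A = dup T *ᵥ vechM A`
for every symmetric T×T matrix A. -/
def dup (T : ℕ) : Matrix (Fin T × Fin T) (VechIdx T) ℝ :=
  Matrix.of fun p q =>
    if (p.1 = q.val.1 ∧ p.2 = q.val.2) ∨ (p.1 = q.val.2 ∧ p.2 = q.val.1) then 1 else 0

/-- Moore–Penrose inverse of the duplication matrix. -/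
def dupPlus (T : ℕ) : Matrix (VechIdx T) (Fin T × Fin T) ℝ :=
  ((dup T)ᵀ * dup T)⁻¹ * (dup T)ᵀ

/-- M_T = 2 D⁺ (G ⊗ G) D⁺′ with G the tridiagonal Δ_T(1,2,-1). -/
def MMat (T : ℕ) : Matrix (VechIdx T) (VechIdx T) ℝ :=
  (2 : ℝ) • (dupPlus T * (tri T 1 2 (-1) ⊗ₖ tri T 1 2 (-1)) * (dupPlus T)ᵀ)


/-- A_T = Δ_T(−(T−1)/2, −(T−2)/3, (T+1)/6). -/
def AMat (T : ℕ) : Matrix (Fin T) (Fin T) ℝ :=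
  tri T (-(((T : ℝ) - 1) / 2)) (-(((T : ℝ) - 2) / 3)) (((T : ℝ) + 1) / 6)

/-- The explicit inverse of `tri T 1 2 (-1)`, with entries `T - max i j`. -/
def triInv (T : ℕ) : Matrix (Fin T) (Fin T) ℝ :=
  Matrix.of fun i j => (T : ℝ) - (max (i : ℕ) (j : ℕ) : ℕ)

lemma sum_tri_mul (T : ℕ) (f : ℕ → ℝ) (hf : f T = 0) (i : Fin T) :
    ∑ k : Fin T, tri T 1 2 (-1) i k * f k =
      (if (i : ℕ) = 0 then f i else 2 * f i - f (i - 1)) - f (i + 1) := by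
  have hsplit : ∀ k : Fin T, tri T 1 2 (-1) i k * f k =
      (if (i : ℕ) = k then (if (i : ℕ) = 0 then 1 else 2) * f i else 0)
        - (if (i : ℕ) + 1 = k then f (i + 1) else 0)
        - (if (k : ℕ) + 1 = i then f (i - 1) else 0) := by
    intro k
    simp only [tri, Matrix.of_apply]
    grind
  have hnext : ∑ k : Fin T, (if (i : ℕ) + 1 = k then f (i + 1) else 0) = f (i + 1) := by
    rw [Fin.sum_univ_eq_sum_range (fun k => if (i : ℕ) + 1 = k then f (i + 1) else 0),
      Finset.sum_ite_eq]
    split_ifs with h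
    · rfl
    · rw [Finset.mem_range] at h
      rw [show (i : ℕ) + 1 = T by omega, hf]
  have hprev : ∑ k : Fin T, (if (k : ℕ) + 1 = i then f (i - 1) else 0) =
      if (i : ℕ) = 0 then 0 else f (i - 1) := by
    rw [Fin.sum_univ_eq_sum_range (fun k => if k + 1 = (i : ℕ) then f (i - 1) else 0)]
    split_ifs with h
    · simp [h]
    · rw [Finset.sum_congr rfl (g := fun k => if (i : ℕ) - 1 = k then f (i - 1) else 0)
        (fun k _ => if_congr (by omega) rfl rfl), Finset.sum_ite_eq, if_pos]
      rw [Finset.mem_range]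
      omega
  have hdiag : ∑ k : Fin T, (if (i : ℕ) = k then (if (i : ℕ) = 0 then 1 else 2) * f i else 0) =
      (if (i : ℕ) = 0 then 1 else 2) * f i := by
    simp only [← Fin.ext_iff, Finset.sum_ite_eq, Finset.mem_univ, if_true]
  rw [Finset.sum_congr rfl fun k _ => hsplit k, Finset.sum_sub_distrib, Finset.sum_sub_distrib,
    hdiag, hnext, hprev]
  split_ifs <;> ring

lemma tri_mul_triInv (T : ℕ) : tri T 1 2 (-1) * triInv T = 1 := by
  ext i j
  have hj := j.isLt
  rw [Matrix.mul_apply]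
  refine (sum_tri_mul T (fun k => (T : ℝ) - (max k (j : ℕ) : ℕ))
    (by rw [max_eq_left hj.le, sub_self]) i).trans ?_
  simp only [Matrix.one_apply, Fin.ext_iff]
  rcases lt_trichotomy (i : ℕ) j with h | h | h
  · rw [max_eq_right (show (i : ℕ) ≤ j by omega), max_eq_right (show (i : ℕ) - 1 ≤ j by omega),
      max_eq_right (show (i : ℕ) + 1 ≤ j by omega), if_neg h.ne]
    split_ifs <;> ring
  · rw [if_pos h, h, max_self, max_eq_right (show (j : ℕ) - 1 ≤ j by omega),
      max_eq_left (show (j : ℕ) ≤ j + 1 by omega)]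
    split_ifs <;> push_cast <;> ring
  · have hi : 1 ≤ (i : ℕ) := by omega
    rw [max_eq_left h.le, max_eq_left (show (j : ℕ) ≤ i - 1 by omega),
      max_eq_left (show (j : ℕ) ≤ i + 1 by omega), if_neg h.ne', if_neg (by omega)]
    push_cast [Nat.cast_sub hi]
    ring

lemma tri_inv (T : ℕ) : (tri T 1 2 (-1))⁻¹ = triInv T :=
  Matrix.inv_eq_right_inv (tri_mul_triInv T)

lemma triInv_transpose (T : ℕ) : (triInv T)ᵀ = triInv T := by
  ext i j
  simp [triInv, max_comm]

lemma tri_transpose (n : ℕ) (a b c : ℝ) : (tri n a b c)ᵀ = tri n a b c := by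
  ext i j
  simp only [tri, Matrix.transpose_apply, Matrix.of_apply]
  grind

lemma sum_sub_sq (n : ℕ) :
    ∑ i : Fin n, ((n : ℝ) - (i : ℕ)) ^ 2 = n * (n + 1) * (2 * n + 1) / 6 := by
  induction n with
  | zero => simp
  | succ n ih =>
    rw [Fin.sum_univ_succ]
    simp only [Fin.val_zero, Fin.val_succ, Nat.cast_add, Nat.cast_one, Nat.cast_zero,
      add_sub_add_right_eq_sub, ih]
    ring

lemma trace_triInv (n : ℕ) : (triInv n).trace = n * (n + 1) / 2 := by
  simp only [Matrix.trace, Matrix.diag_apply, triInv, Matrix.of_apply, max_self]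
  induction n with
  | zero => simp
  | succ n ih =>
    rw [Fin.sum_univ_succ]
    simp only [Fin.val_zero, Fin.val_succ, Nat.cast_add, Nat.cast_one, Nat.cast_zero,
      add_sub_add_right_eq_sub, ih]
    ring

lemma trace_triInv_mul_self (n : ℕ) :
    (triInv n * triInv n).trace = n * (n + 1) * (n ^ 2 + n + 1) / 6 := by
  have hsq : (triInv n * triInv n).trace =
      ∑ i : Fin n, ∑ j : Fin n, ((n : ℝ) - (max (i : ℕ) (j : ℕ) : ℕ)) ^ 2 := by
    simp only [Matrix.trace, Matrix.diag_apply, Matrix.mul_apply]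
    refine Finset.sum_congr rfl fun i _ => Finset.sum_congr rfl fun j _ => ?_
    simp only [triInv, Matrix.of_apply, max_comm (j : ℕ) i, sq]
  rw [hsq]
  clear hsq
  induction n with
  | zero => simp
  | succ n ih =>
    simp only [Fin.sum_univ_succ, Fin.val_zero, Fin.val_succ, Nat.max_zero, Nat.zero_max,
      Nat.add_max_add_right, Nat.cast_add, Nat.cast_one, Nat.cast_zero,
      add_sub_add_right_eq_sub, Finset.sum_add_distrib, ih, sum_sub_sq]
    ring

lemma AMat_succ (n : ℕ) :
    AMat (n + 1) = 1 - (((n : ℝ) + 2) / 6) • tri (n + 1) 1 2 (-1)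
      - (((n : ℝ) + 2) / 3) • Matrix.single 0 0 1 := by
  ext i j
  simp only [AMat, tri, Matrix.sub_apply, Matrix.smul_apply, Matrix.one_apply, Matrix.of_apply,
    Matrix.single_apply, Fin.ext_iff, Fin.val_zero, smul_eq_mul]
  push_cast
  split_ifs <;> first | omega | ring

lemma AMat_mul_triInv (n : ℕ) :
    AMat (n + 1) * triInv (n + 1) = triInv (n + 1) - (((n : ℝ) + 2) / 6) • 1
      - (((n : ℝ) + 2) / 3) • (Matrix.single 0 0 1 * triInv (n + 1)) := by
  rw [AMat_succ, sub_mul, sub_mul, one_mul, smul_mul_assoc, smul_mul_assoc, tri_mul_triInv]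

lemma trace_single_mul_triInv_mul_triInv (n : ℕ) :
    (Matrix.single 0 0 1 * triInv (n + 1) * triInv (n + 1)).trace =
      ((n : ℝ) + 1) * (n + 2) * (2 * n + 3) / 6 := by
  rw [mul_assoc, Matrix.trace_single_mul, Matrix.mul_apply]
  have h := sum_sub_sq (n + 1)
  push_cast at h
  simp only [triInv, Matrix.of_apply, Fin.val_zero, Nat.max_zero, Nat.zero_max, ← sq, one_smul]
  push_cast
  rw [h]
  ring

lemma single_mul_triInv_mul_self (n : ℕ) :
    (Matrix.single 0 0 1 * triInv (n + 1)) * (Matrix.single 0 0 1 * triInv (n + 1)) =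
      ((n : ℝ) + 1) • (Matrix.single 0 0 1 * triInv (n + 1)) := by
  rw [← mul_assoc, Matrix.single_mul_mul_single, ← smul_mul_assoc, Matrix.smul_single]
  simp [triInv]

lemma trace_single_mul_triInv (n : ℕ) :
    (Matrix.single 0 0 1 * triInv (n + 1)).trace = (n : ℝ) + 1 := by
  simp [Matrix.trace_single_mul, triInv]

lemma trace_AMat_mul_triInv_mul_self (n : ℕ) :
    ((AMat (n + 1) * triInv (n + 1)) * (AMat (n + 1) * triInv (n + 1))).trace =
      (2 * (n : ℝ) + 1) * (n + 2) * (n + 1) * n / 36 := by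
  rw [AMat_mul_triInv]
  have hcomm : (triInv (n + 1) * (Matrix.single 0 0 1 * triInv (n + 1))).trace =
      (Matrix.single 0 0 1 * triInv (n + 1) * triInv (n + 1)).trace := Matrix.trace_mul_comm _ _
  simp only [sub_mul, mul_sub, Matrix.trace_sub, smul_mul_assoc, mul_smul_comm, Matrix.trace_smul,
    one_mul, mul_one, single_mul_triInv_mul_self, hcomm, trace_single_mul_triInv_mul_triInv,
    trace_single_mul_triInv, trace_triInv, trace_triInv_mul_self, Matrix.trace_one,
    Fintype.card_fin, smul_eq_mul]
  push_cast
  ring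

/-- vec(A_T)′ (G_T⁻¹ ⊗ G_T⁻¹) vec(A_T) = (2T−1)(T+1)T(T−1)/36. -/
theorem stmt_4 (T : ℕ) (hT : 2 ≤ T) :
    vecM (AMat T) ⬝ᵥ (((tri T 1 2 (-1))⁻¹ ⊗ₖ (tri T 1 2 (-1))⁻¹) *ᵥ vecM (AMat T)) =
      (2 * (T : ℝ) - 1) * ((T : ℝ) + 1) * (T : ℝ) * ((T : ℝ) - 1) / 36 := by
  obtain ⟨n, rfl⟩ : ∃ n, T = n + 1 := ⟨T - 1, by omega⟩
  change (AMat (n + 1)).vec ⬝ᵥ (_ *ᵥ (AMat (n + 1)).vec) = _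
  have hA : (AMat (n + 1))ᵀ = AMat (n + 1) := tri_transpose _ _ _ _
  rw [tri_inv, Matrix.kronecker_mulVec_vec, Matrix.vec_dotProduct_vec, hA, triInv_transpose,
    ← mul_assoc, ← mul_assoc, mul_assoc (_ * _), trace_AMat_mul_triInv_mul_self]
  push_cast
  ring
end
end

section
/- Let T ≥ 2, let P be the (T−1)×(T−1) real matrix with P_{ij} = 1 if i > j and P_{ij} = 0 if i ≤ j (1-based indexing), let ι ∈ ℝ^{T−1} be the vector of ones, and let Q = I_{T−1} − ιι′/(T−1). Then tr(P′PQP) = −(T−2)T(T+1)/24. -/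
open Matrix
open scoped Matrix

noncomputable section

/-- the (T−1)×(T−1) strictly lower triangular matrix of ones. -/
def lowOnes (T : ℕ) : Matrix (Fin (T - 1)) (Fin (T - 1)) ℝ :=
  Matrix.of fun i j => if (j : ℕ) < (i : ℕ) then 1 else 0

/-- the all-ones vector in ℝ^{T−1}. -/
def iotaV (T : ℕ) : Fin (T - 1) → ℝ := fun _ => 1

/-- Q = I_{T−1} − ιι′/(T−1), the centering projection matrix. -/
def QMat (T : ℕ) : Matrix (Fin (T - 1)) (Fin (T - 1)) ℝ :=
  1 - ((T : ℝ) - 1)⁻¹ • Matrix.vecMulVec (iotaV T) (iotaV T)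

/-- Multiplying a vector by the strictly lower triangular matrix of ones takes partial sums. -/
lemma lowOnes_mulVec (n : ℕ) (f : ℕ → ℝ) (i : Fin n) :
    (lowOnes (n + 1) *ᵥ fun j : Fin n => f j) i = ∑ j ∈ Finset.range i, f j := by
  have h : (lowOnes (n + 1) *ᵥ fun j : Fin n => f j) i =
      ∑ j : Fin n, if (j : ℕ) < (i : ℕ) then f j else 0 := by
    simp [Matrix.mulVec, dotProduct, lowOnes]
  rw [h, Fin.sum_univ_eq_sum_range (fun j => if j < (i : ℕ) then f j else 0), ← Finset.sum_filter]
  congr 1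
  ext j
  simp only [Finset.mem_filter, Finset.mem_range]
  omega

lemma lowOnes_mulVec_iotaV (n : ℕ) :
    lowOnes (n + 1) *ᵥ iotaV (n + 1) = fun i : Fin n => ((i : ℕ) : ℝ) := by
  ext i
  exact (lowOnes_mulVec n (fun _ => 1) i).trans (by simp)

lemma lowOnes_transpose_mulVec_iotaV (n : ℕ) :
    (lowOnes (n + 1))ᵀ *ᵥ iotaV (n + 1) = fun j : Fin n => (n : ℝ) - 1 - ((j : ℕ) : ℝ) := by
  ext j
  have h : ((lowOnes (n + 1))ᵀ *ᵥ iotaV (n + 1)) j =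
      ∑ i : Fin n, if (j : ℕ) < (i : ℕ) then (1 : ℝ) else 0 := by
    simp [Matrix.mulVec, dotProduct, lowOnes, iotaV]
  rw [h, Fin.sum_univ_eq_sum_range (fun i => if (j : ℕ) < i then (1 : ℝ) else 0),
    ← Finset.sum_filter]
  have hs : (Finset.range n).filter (fun i => (j : ℕ) < i) = Finset.Ico ((j : ℕ) + 1) n := by
    ext i
    simp only [Finset.mem_filter, Finset.mem_range, Finset.mem_Ico]
    omega
  have hj : (j : ℕ) + 1 ≤ n := j.isLt
  rw [hs, Finset.sum_const, Nat.card_Ico, nsmul_eq_mul, Nat.cast_sub hj]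
  push_cast
  ring

lemma trace_transpose_mul_centering_mul {m : Type*} [Fintype m] [DecidableEq m]
    (A : Matrix m m ℝ) (c : ℝ) (u : m → ℝ) :
    trace (Aᵀ * A * (1 - c • vecMulVec u u) * A) =
      trace (Aᵀ * A * A) - c * ((A *ᵥ u) ⬝ᵥ (A *ᵥ (Aᵀ *ᵥ u))) := by
  rw [Matrix.mul_sub, Matrix.sub_mul, Matrix.trace_sub, Matrix.mul_one, Matrix.mul_smul,
    Matrix.smul_mul, Matrix.trace_smul, smul_eq_mul, Matrix.mul_vecMulVec, Matrix.vecMulVec_mul,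
    Matrix.trace_vecMulVec, ← Matrix.mulVec_mulVec, Matrix.mulVec_transpose,
    ← Matrix.dotProduct_mulVec, Matrix.mulVec_transpose]

/-- The relation `<` is transitive, so the outer factor in `tr (Pᵀ P P)` is redundant. -/
lemma trace_lowOnes (n : ℕ) :
    trace ((lowOnes (n + 1))ᵀ * lowOnes (n + 1) * lowOnes (n + 1)) =
      ∑ i : Fin n, (lowOnes (n + 1) *ᵥ (lowOnes (n + 1) *ᵥ iotaV (n + 1))) i := by
  rw [Matrix.mul_assoc, Matrix.trace_mul_comm, Matrix.trace]
  refine Finset.sum_congr rfl fun i _ => ?_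
  rw [Matrix.mulVec_mulVec, Matrix.diag_apply, Matrix.mul_apply, Matrix.mulVec, dotProduct]
  refine Finset.sum_congr rfl fun j _ => ?_
  simp only [Matrix.mul_apply, Matrix.transpose_apply, iotaV, mul_one, Finset.sum_mul]
  refine Finset.sum_congr rfl fun k _ => ?_
  simp only [lowOnes, Matrix.of_apply]
  split_ifs <;> first | omega | simp

lemma sum_range_cast (n : ℕ) : ∑ i ∈ Finset.range n, (i : ℝ) = n * (n - 1) / 2 := by
  induction n with
  | zero => simp
  | succ n ih => rw [Finset.sum_range_succ, ih]; push_cast; ring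

lemma sum_range_choose_two (n : ℕ) :
    ∑ i ∈ Finset.range n, ((i : ℝ) * (i - 1) / 2) = n * (n - 1) * (n - 2) / 6 := by
  induction n with
  | zero => simp
  | succ n ih => rw [Finset.sum_range_succ, ih]; push_cast; ring

lemma sum_range_mul_partial_sum (n : ℕ) (a : ℝ) :
    ∑ i ∈ Finset.range n, ((i : ℝ) * (i * a - i * (i - 1) / 2)) =
      n * (n - 1) * (2 * n - 1) / 6 * (a + 1 / 2) - (n * (n - 1) / 2) ^ 2 / 2 := by
  induction n with
  | zero => simp
  | succ n ih => rw [Finset.sum_range_succ, ih]; push_cast; ring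

/-- tr(P′PQP) = −(T−2)T(T+1)/24. -/
theorem stmt_16 (T : ℕ) (hT : 2 ≤ T) :
    Matrix.trace ((lowOnes T)ᵀ * lowOnes T * QMat T * lowOnes T) =
      -(((T : ℝ) - 2) * (T : ℝ) * ((T : ℝ) + 1) / 24) := by
  obtain ⟨n, rfl⟩ : ∃ n, T = n + 1 := ⟨T - 1, by omega⟩
  have hn : (n : ℝ) ≠ 0 := by
    have : n ≠ 0 := by omega
    exact_mod_cast this
  have h₁ : trace ((lowOnes (n + 1))ᵀ * lowOnes (n + 1) * lowOnes (n + 1)) =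
      (n : ℝ) * (n - 1) * (n - 2) / 6 := by
    rw [trace_lowOnes, lowOnes_mulVec_iotaV, ← sum_range_choose_two,
      ← Fin.sum_univ_eq_sum_range (fun i => (i : ℝ) * (i - 1) / 2)]
    refine Finset.sum_congr rfl fun i _ => ?_
    exact (lowOnes_mulVec n (fun j => (j : ℝ)) i).trans (sum_range_cast i)
  have h₂ : (lowOnes (n + 1) *ᵥ iotaV (n + 1)) ⬝ᵥ
      (lowOnes (n + 1) *ᵥ ((lowOnes (n + 1))ᵀ *ᵥ iotaV (n + 1))) =
      (n : ℝ) * (n - 1) * (2 * n - 1) / 6 * ((n - 1) + 1 / 2) - (n * (n - 1) / 2) ^ 2 / 2 := by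
    rw [lowOnes_mulVec_iotaV, lowOnes_transpose_mulVec_iotaV, ← sum_range_mul_partial_sum,
      ← Fin.sum_univ_eq_sum_range
        (fun i => (i : ℝ) * (i * ((n : ℝ) - 1) - i * (i - 1) / 2)), dotProduct]
    refine Finset.sum_congr rfl fun i _ => ?_
    congr 1
    refine (lowOnes_mulVec n (fun j => (n : ℝ) - 1 - (j : ℝ)) i).trans ?_
    rw [Finset.sum_sub_distrib, sum_range_cast, Finset.sum_const, Finset.card_range, nsmul_eq_mul]
  rw [QMat, trace_transpose_mul_centering_mul, h₁, h₂]
  push_cast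
  rw [add_sub_cancel_right]
  field_simp
  ring
end
end
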